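/- Let (X,d) be a compact metric space and F a finite nonempty set of continuous self-maps of X. Then F is super-weakly mixing if and only if the induced map F̄ on the hyperspace K(X) of nonempty compact subsets of X, equipped with the Hausdorff metric d_H, is weakly mixing. -/

import Mathlib

open Set Filter Metric TopologicalSpace

/-- The image of a set `A` under a relation given by a family `F` of self-maps:
`F(A) = ⋃_{f ∈ F} f(A)`. -/
def relImage {X : Type*} (F : Set (X → X)) (A : Set X) : Set X :=
  ⋃ f ∈ F, f '' A

/-- `F^n(x)`: the set of values at `x` of all `n`-fold compositions of members of `F`. -/
def relIter {X : Type*} (F : Set (X → X)) (n : ℕ) (x : X) : Set X :=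
  (relImage F)^[n] {x}

/-- `F` is super-weakly mixing if for all nonempty open sets `U₁, U₂, V₁, V₂` there exist
`n ≥ 1` and `x_i ∈ U_i` with `F^n(x_i) ⊆ V_i` for `i = 1, 2`. -/
def SuperWeaklyMixing {X : Type*} [TopologicalSpace X] (F : Set (X → X)) : Prop :=
  ∀ U₁ U₂ V₁ V₂ : Set X, IsOpen U₁ → IsOpen U₂ → IsOpen V₁ → IsOpen V₂ →
    U₁.Nonempty → U₂.Nonempty → V₁.Nonempty → V₂.Nonempty →
    ∃ n : ℕ, 1 ≤ n ∧ ∃ x₁ ∈ U₁, ∃ x₂ ∈ U₂, relIter F n x₁ ⊆ V₁ ∧ relIter F n x₂ ⊆ V₂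

/-- A self-map `g` of a topological space is weakly mixing if for all nonempty open sets
`𝒰₁, 𝒰₂, 𝒱₁, 𝒱₂` there is `n ≥ 1` with `g^n(𝒰ᵢ) ∩ 𝒱ᵢ ≠ ∅` for `i = 1, 2`. -/
def WeaklyMixingMap {Y : Type*} [TopologicalSpace Y] (g : Y → Y) : Prop :=
  ∀ U₁ U₂ V₁ V₂ : Set Y, IsOpen U₁ → IsOpen U₂ → IsOpen V₁ → IsOpen V₂ →
    U₁.Nonempty → U₂.Nonempty → V₁.Nonempty → V₂.Nonempty →
    ∃ n : ℕ, 1 ≤ n ∧ (g^[n] '' U₁ ∩ V₁).Nonempty ∧ (g^[n] '' U₂ ∩ V₂).Nonempty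

/-- The largest set mapped into `V` by every member of `F`; it is the upper adjoint of
`relImage F`. -/
def relCore {X : Type*} (F : Set (X → X)) (V : Set X) : Set X :=
  {x | ∀ f ∈ F, f x ∈ V}

section relCore

variable {X : Type*} {F : Set (X → X)}

theorem relImage_subset_iff {A V : Set X} : relImage F A ⊆ V ↔ A ⊆ relCore F V := by
  simp only [relImage, relCore, iUnion_subset_iff, image_subset_iff]
  exact ⟨fun h x hx f hf => h f hf hx, fun h f hf x hx => h hx f hf⟩

theorem iterate_relImage_subset_iff (n : ℕ) {A V : Set X} :
    (relImage F)^[n] A ⊆ V ↔ A ⊆ (relCore F)^[n] V := by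
  induction n generalizing A with
  | zero => rfl
  | succ n ih =>
    rw [Function.iterate_succ_apply, Function.iterate_succ_apply', ih, relImage_subset_iff]

theorem relIter_subset_iff (n : ℕ) {x : X} {V : Set X} :
    relIter F n x ⊆ V ↔ x ∈ (relCore F)^[n] V := by
  rw [relIter, iterate_relImage_subset_iff, singleton_subset_iff]

theorem monotone_iterate_relImage (n : ℕ) : Monotone (relImage F)^[n] := by
  intro A B hAB
  exact (iterate_relImage_subset_iff n).2
    (hAB.trans ((iterate_relImage_subset_iff n).1 subset_rfl))

theorem iterate_relCore_inter (n : ℕ) (A B : Set X) :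
    (relCore F)^[n] (A ∩ B) = (relCore F)^[n] A ∩ (relCore F)^[n] B := by
  ext x
  simp only [mem_inter_iff, ← relIter_subset_iff, subset_inter_iff]

theorem relImage_nonempty (hF : F.Nonempty) {A : Set X} (hA : A.Nonempty) :
    (relImage F A).Nonempty := by
  obtain ⟨f, hf⟩ := hF
  obtain ⟨x, hx⟩ := hA
  exact ⟨f x, mem_biUnion hf (mem_image_of_mem f hx)⟩

theorem iterate_relImage_nonempty (hF : F.Nonempty) (n : ℕ) {A : Set X} (hA : A.Nonempty) :
    ((relImage F)^[n] A).Nonempty := by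
  induction n generalizing A with
  | zero => exact hA
  | succ n ih => exact ih (relImage_nonempty hF hA)

theorem nonempty_of_iterate_relCore_nonempty (hF : F.Nonempty) (n : ℕ) {V : Set X}
    (hV : ((relCore F)^[n] V).Nonempty) : V.Nonempty :=
  (iterate_relImage_nonempty hF n hV).mono ((iterate_relImage_subset_iff n).2 subset_rfl)

variable [TopologicalSpace X]

theorem isOpen_relCore (hF : F.Finite) (hFc : ∀ f ∈ F, Continuous f) {V : Set X}
    (hV : IsOpen V) : IsOpen (relCore F V) := by
  have : relCore F V = ⋂ f ∈ F, f ⁻¹' V := by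
    ext x
    simp [relCore]
  rw [this]
  exact hF.isOpen_biInter fun f hf => hV.preimage (hFc f hf)

theorem isOpen_iterate_relCore (hF : F.Finite) (hFc : ∀ f ∈ F, Continuous f) (n : ℕ)
    {V : Set X} (hV : IsOpen V) : IsOpen ((relCore F)^[n] V) := by
  induction n generalizing V with
  | zero => exact hV
  | succ n ih => exact ih (isOpen_relCore hF hFc hV)

/-- The hitting times of two pairs of open sets contain the hitting times of a single pair. -/
theorem SuperWeaklyMixing.exists_inter (h : SuperWeaklyMixing F) (hF : F.Finite)
    (hFne : F.Nonempty) (hFc : ∀ f ∈ F, Continuous f) {U₁ U₂ V₁ V₂ : Set X}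
    (oU₁ : IsOpen U₁) (oU₂ : IsOpen U₂) (oV₁ : IsOpen V₁) (oV₂ : IsOpen V₂)
    (nU₁ : U₁.Nonempty) (nU₂ : U₂.Nonempty) (nV₁ : V₁.Nonempty) (nV₂ : V₂.Nonempty) :
    ∃ U V : Set X, IsOpen U ∧ IsOpen V ∧ U.Nonempty ∧ V.Nonempty ∧
      ∀ k, (U ∩ (relCore F)^[k] V).Nonempty →
        (U₁ ∩ (relCore F)^[k] V₁).Nonempty ∧ (U₂ ∩ (relCore F)^[k] V₂).Nonempty := by
  obtain ⟨n, -, x, hx, y, hy, hxU, hyV⟩ := h U₁ V₁ U₂ V₂ oU₁ oV₁ oU₂ oV₂ nU₁ nV₁ nU₂ nV₂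
  rw [relIter_subset_iff] at hxU hyV
  refine ⟨U₁ ∩ (relCore F)^[n] U₂, V₁ ∩ (relCore F)^[n] V₂,
    oU₁.inter (isOpen_iterate_relCore hF hFc n oU₂),
    oV₁.inter (isOpen_iterate_relCore hF hFc n oV₂), ⟨x, hx, hxU⟩, ⟨y, hy, hyV⟩, ?_⟩
  rintro k ⟨z, ⟨hz₁, hz₂⟩, hzV⟩
  rw [iterate_relCore_inter, ← Function.iterate_add_apply, Nat.add_comm,
    Function.iterate_add_apply] at hzV
  refine ⟨⟨z, hz₁, hzV.1⟩, nonempty_of_iterate_relCore_nonempty hFne n ⟨z, ?_⟩⟩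
  rw [iterate_relCore_inter]
  exact ⟨hz₂, hzV.2⟩

/-- The hitting times of finitely many pairs of open sets contain the hitting times of a single
pair. -/
theorem SuperWeaklyMixing.exists_finite_inter [Nonempty X] (h : SuperWeaklyMixing F)
    (hF : F.Finite) (hFne : F.Nonempty) (hFc : ∀ f ∈ F, Continuous f)
    {s : Set (Set X × Set X)} (hs : s.Finite)
    (hso : ∀ p ∈ s, IsOpen p.1 ∧ IsOpen p.2 ∧ p.1.Nonempty ∧ p.2.Nonempty) :
    ∃ U V : Set X, IsOpen U ∧ IsOpen V ∧ U.Nonempty ∧ V.Nonempty ∧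
      ∀ k, (U ∩ (relCore F)^[k] V).Nonempty →
        ∀ p ∈ s, (p.1 ∩ (relCore F)^[k] p.2).Nonempty := by
  induction s, hs using Set.Finite.induction_on with
  | empty =>
    exact ⟨univ, univ, isOpen_univ, isOpen_univ, univ_nonempty, univ_nonempty, by simp⟩
  | @insert p s _ _ ih =>
    obtain ⟨U, V, oU, oV, nU, nV, hUV⟩ := ih fun q hq => hso q (mem_insert_of_mem p hq)
    obtain ⟨op₁, op₂, np₁, np₂⟩ := hso p (mem_insert p s)
    obtain ⟨U', V', oU', oV', nU', nV', hUV'⟩ :=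
      h.exists_inter hF hFne hFc op₁ oU op₂ oV np₁ nU np₂ nV
    refine ⟨U', V', oU', oV', nU', nV', fun k hk => ?_⟩
    obtain ⟨hp, hq⟩ := hUV' k hk
    exact forall_mem_insert.2 ⟨hp, hUV k hq⟩

theorem coe_iterate_of_coe_eq_relImage {Fbar : NonemptyCompacts X → NonemptyCompacts X}
    (hFbar : ∀ A : NonemptyCompacts X, (Fbar A : Set X) = relImage F (A : Set X)) (n : ℕ)
    (A : NonemptyCompacts X) : (Fbar^[n] A : Set X) = (relImage F)^[n] (A : Set X) := by
  induction n generalizing A with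
  | zero => rfl
  | succ n ih => rw [Function.iterate_succ_apply, Function.iterate_succ_apply, ih, hFbar]

/-- The hitting times of a pair of open sets of the hyperspace contain the hitting times of a pair
of open sets of the base space. -/
theorem SuperWeaklyMixing.exists_hyperspace (h : SuperWeaklyMixing F) (hF : F.Finite)
    (hFne : F.Nonempty) (hFc : ∀ f ∈ F, Continuous f)
    {Fbar : NonemptyCompacts X → NonemptyCompacts X}
    (hFbar : ∀ A : NonemptyCompacts X, (Fbar A : Set X) = relImage F (A : Set X))
    {𝒰 𝒱 : Set (NonemptyCompacts X)} (o𝒰 : IsOpen 𝒰) (o𝒱 : IsOpen 𝒱)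
    (n𝒰 : 𝒰.Nonempty) (n𝒱 : 𝒱.Nonempty) :
    ∃ U V : Set X, IsOpen U ∧ IsOpen V ∧ U.Nonempty ∧ V.Nonempty ∧
      ∀ k, (U ∩ (relCore F)^[k] V).Nonempty → (Fbar^[k] '' 𝒰 ∩ 𝒱).Nonempty := by
  obtain ⟨A, hA⟩ := n𝒰
  obtain ⟨B, hB⟩ := n𝒱
  obtain ⟨_, ⟨u, ⟨fu, ⟨U₀, hU₀⟩, ou⟩, rfl⟩, hAu, hu𝒰⟩ :=
    NonemptyCompacts.isTopologicalBasis.exists_subset_of_mem_open hA o𝒰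
  obtain ⟨_, ⟨v, ⟨fv, ⟨V₀, hV₀⟩, ov⟩, rfl⟩, hBv, hv𝒱⟩ :=
    NonemptyCompacts.isTopologicalBasis.exists_subset_of_mem_open hB o𝒱
  have : Nonempty X := A.nonempty.to_type
  obtain ⟨U, V, oU, oV, nU, nV, hUV⟩ := h.exists_finite_inter hF hFne hFc (fu.prod fv)
    fun p hp => ⟨ou _ hp.1, ov _ hp.2, (hAu.2 _ hp.1).right, (hBv.2 _ hp.2).right⟩
  refine ⟨U, V, oU, oV, nU, nV, fun k hk => ?_⟩
  choose! x hxU hxV using hUV k hk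
  let C : NonemptyCompacts X :=
    ⟨⟨x '' u ×ˢ v, ((fu.prod fv).image x).isCompact⟩, ⟨_, mem_image_of_mem x (mk_mem_prod hU₀ hV₀)⟩⟩
  have hC : (C : Set X) = x '' u ×ˢ v := rfl
  refine ⟨Fbar^[k] C, mem_image_of_mem _ (hu𝒰 ⟨?_, fun U' hU' => ?_⟩), hv𝒱 ⟨?_, fun V' hV' => ?_⟩⟩
  · rintro _ ⟨p, hp, rfl⟩
    exact ⟨p.1, hp.1, hxU p hp⟩
  · exact ⟨_, mem_image_of_mem x (mk_mem_prod hU' hV₀), hxU (U', V₀) ⟨hU', hV₀⟩⟩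
  · rw [coe_iterate_of_coe_eq_relImage hFbar, iterate_relImage_subset_iff, hC]
    rintro _ ⟨p, hp, rfl⟩
    exact (relIter_subset_iff k).1
      (((relIter_subset_iff k).2 (hxV p hp)).trans (subset_sUnion_of_mem hp.2))
  · rw [coe_iterate_of_coe_eq_relImage hFbar, hC]
    have hp : (U₀, V') ∈ u ×ˢ v := ⟨hU₀, hV'⟩
    exact (iterate_relImage_nonempty hFne k (singleton_nonempty (x (U₀, V')))).mono
      (subset_inter
        (monotone_iterate_relImage k (singleton_subset_iff.2 (mem_image_of_mem x hp)))
        ((relIter_subset_iff k).2 (hxV _ hp)))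

theorem WeaklyMixingMap.superWeaklyMixing
    {Fbar : NonemptyCompacts X → NonemptyCompacts X}
    (hFbar : ∀ A : NonemptyCompacts X, (Fbar A : Set X) = relImage F (A : Set X))
    (h : WeaklyMixingMap Fbar) : SuperWeaklyMixing F := by
  have key : ∀ (n : ℕ) {U V : Set X},
      (Fbar^[n] '' {K | ↑K ⊆ U} ∩ {K | ↑K ⊆ V}).Nonempty → ∃ x ∈ U, relIter F n x ⊆ V := by
    rintro n U V ⟨_, ⟨A, hA, rfl⟩, hAV⟩
    obtain ⟨x, hx⟩ := A.nonempty
    refine ⟨x, hA hx, (monotone_iterate_relImage n (singleton_subset_iff.2 hx)).trans ?_⟩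
    exact (coe_iterate_of_coe_eq_relImage hFbar n A).symm.subset.trans hAV
  have ne : ∀ {U : Set X}, U.Nonempty → {K : NonemptyCompacts X | ↑K ⊆ U}.Nonempty := by
    rintro U ⟨x, hx⟩
    exact ⟨{x}, by simpa using hx⟩
  intro U₁ U₂ V₁ V₂ oU₁ oU₂ oV₁ oV₂ nU₁ nU₂ nV₁ nV₂
  obtain ⟨n, hn, h₁, h₂⟩ := h _ _ _ _
    (NonemptyCompacts.isOpen_subsets_of_isOpen oU₁) (NonemptyCompacts.isOpen_subsets_of_isOpen oU₂)
    (NonemptyCompacts.isOpen_subsets_of_isOpen oV₁) (NonemptyCompacts.isOpen_subsets_of_isOpen oV₂)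
    (ne nU₁) (ne nU₂) (ne nV₁) (ne nV₂)
  obtain ⟨x₁, hx₁, hV₁⟩ := key n h₁
  obtain ⟨x₂, hx₂, hV₂⟩ := key n h₂
  exact ⟨n, hn, x₁, hx₁, x₂, hx₂, hV₁, hV₂⟩

end relCore

/-- A finite nonempty family `F` of continuous self-maps of a compact metric space is
super-weakly mixing iff the induced map `F̄(A) = ⋃_{f ∈ F} f(A)` on the hyperspace `K(X)` of
nonempty compact subsets of `X`, with the Hausdorff metric, is weakly mixing. -/
theorem stmt_7 {X : Type*} [MetricSpace X] [CompactSpace X]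
    (F : Set (X → X)) (hFfin : F.Finite) (hFne : F.Nonempty)
    (hFcont : ∀ f ∈ F, Continuous f)
    (Fbar : NonemptyCompacts X → NonemptyCompacts X)
    (hFbar : ∀ A : NonemptyCompacts X, (Fbar A : Set X) = relImage F (A : Set X)) :
    SuperWeaklyMixing F ↔ WeaklyMixingMap Fbar := by
  refine ⟨fun h 𝒰₁ 𝒰₂ 𝒱₁ 𝒱₂ o𝒰₁ o𝒰₂ o𝒱₁ o𝒱₂ n𝒰₁ n𝒰₂ n𝒱₁ n𝒱₂ => ?_,
    WeaklyMixingMap.superWeaklyMixing hFbar⟩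
  obtain ⟨U₁, V₁, oU₁, oV₁, nU₁, nV₁, h₁⟩ :=
    h.exists_hyperspace hFfin hFne hFcont hFbar o𝒰₁ o𝒱₁ n𝒰₁ n𝒱₁
  obtain ⟨U₂, V₂, oU₂, oV₂, nU₂, nV₂, h₂⟩ :=
    h.exists_hyperspace hFfin hFne hFcont hFbar o𝒰₂ o𝒱₂ n𝒰₂ n𝒱₂
  obtain ⟨n, hn, x₁, hx₁, x₂, hx₂, hV₁, hV₂⟩ :=
    h U₁ U₂ V₁ V₂ oU₁ oU₂ oV₁ oV₂ nU₁ nU₂ nV₁ nV₂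
  exact ⟨n, hn, h₁ n ⟨x₁, hx₁, (relIter_subset_iff n).1 hV₁⟩,
    h₂ n ⟨x₂, hx₂, (relIter_subset_iff n).1 hV₂⟩⟩
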